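/- Assume conditions (9), (11), and (12) (i.e., deg_{k_i} P ≤ A_i(n_i+1) − 2 for every i ∈ {1, …, p}). Then the series S(P) is a K-linear combination of multiple zeta values ζ(s_1, …, s_q) with 0 ≤ q ≤ p for which there exist indices 1 ≤ i_1 < … < i_q ≤ p with 2 ≤ s_ℓ ≤ A_{i_ℓ} for every ℓ ∈ {1, …, q}. -/

import Mathlib

/-- The multiple zeta value `ζ(s₁, …, s_q)`, defined as a sum over strictly
decreasing tuples `k₁ > k₂ > … > k_q ≥ 1`.  For the empty list it equals `1`. -/
noncomputable def mzv (s : List ℕ) : ℝ :=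
  ∑' k : {k : Fin s.length → ℕ // StrictAnti k ∧ ∀ i, 1 ≤ k i},
    ∏ i : Fin s.length, ((k.1 i : ℝ) ^ s.get i)⁻¹

/-- The rational function `P(k₁,…,k_p) / ∏ᵢ ((kᵢ+rᵢ)_{nᵢ+1})^{Aᵢ}`. -/
noncomputable def Rfun (p : ℕ) (K : Subfield ℂ) (A n r : ℕ → ℕ)
    (P : MvPolynomial (Fin p) K) (k : Fin p → ℂ) : ℂ :=
  MvPolynomial.eval₂ K.subtype k P /
    ∏ i : Fin p, ((ascPochhammer ℂ (n i.1 + 1)).eval (k i + (r i.1 : ℂ))) ^ A i.1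

open Finset Filter Topology

/-- The function `k ↦ 1 / (k + 1 + a)`. -/
noncomputable def shiftedInv (a : ℕ) : ℕ → ℂ := fun k => ((k : ℂ) + 1 + a)⁻¹

/-- The sequence of partial sums, as a linear map. -/
def partialSum : (ℕ → ℂ) →ₗ[ℂ] (ℕ → ℂ) where
  toFun x N := ∑ k ∈ range N, x k
  map_add' x y := by ext N; simp [sum_add_distrib]
  map_smul' c x := by ext N; simp [mul_sum]

/-- The truncated nested sum `N ↦ ∑ f₁(k₁) ⋯ f_q(k_q)` over `N > k₁ > ⋯ > k_q ≥ 0`. -/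
def nestedSum : List (ℕ → ℂ) → ℕ → ℂ
  | [] => 1
  | f :: L => partialSum (f * nestedSum L)

/-- The truncated multiple zeta value of index `s`. -/
noncomputable def truncMzv (s : List ℕ) : ℕ → ℂ :=
  nestedSum (s.map (shiftedInv 0 ^ ·))

/-- `s` is bounded by a sublist of `B` and has all its entries at least `2`. -/
def DominatedBy (s B : List ℕ) : Prop := List.SublistForall₂ (fun x y => 2 ≤ x ∧ x ≤ y) s B

/-- Rational functions vanishing to order two at infinity, with poles prescribed by `I` and of
order at most `b`. -/
noncomputable def polesSpan (K : Subfield ℂ) (I : Set ℕ) (b : ℕ) : Submodule K (ℕ → ℂ) :=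
  Submodule.span K {x | ∃ M : Multiset ℕ, 2 ≤ M.card ∧ (∀ a ∈ M, a ∈ I ∧ M.count a ≤ b) ∧
    x = (M.map shiftedInv).prod}

/-- The span of the powers of `shiftedInv 0` and of the differences of consecutive shifts. -/
noncomputable def telescopingSpan (K : Subfield ℂ) (u b : ℕ) : Submodule K (ℕ → ℂ) :=
  Submodule.span K ({x | ∃ s, 2 ≤ s ∧ s ≤ b ∧ x = shiftedInv 0 ^ s} ∪
    {x | ∃ a s, a < u ∧ 1 ≤ s ∧ s ≤ b ∧ x = shiftedInv a ^ s - shiftedInv (a + 1) ^ s})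

/-- The span of truncated multiple zeta values together with their products by powers of
`shiftedInv a`, `a < u`, all with indices dominated by `B`. -/
noncomputable def truncMzvSpan (K : Subfield ℂ) (u : ℕ) (B : List ℕ) : Submodule K (ℕ → ℂ) :=
  Submodule.span K ({x | ∃ s, DominatedBy s B ∧ x = truncMzv s} ∪
    {x | ∃ a t s b B', a < u ∧ 1 ≤ t ∧ t ≤ b ∧ List.Sublist (b :: B') B ∧ DominatedBy s B' ∧
      x = shiftedInv a ^ t * truncMzv s})

theorem DominatedBy.mono {s B C : List ℕ} (h : DominatedBy s B) (hBC : List.Sublist B C) :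
    DominatedBy s C := by
  obtain ⟨l, h1, h2⟩ := List.sublistForall₂_iff.1 h
  exact List.sublistForall₂_iff.2 ⟨l, h1, h2.trans hBC⟩

theorem DominatedBy.cons {s B : List ℕ} {t b : ℕ} (h : DominatedBy s B) (ht : 2 ≤ t)
    (htb : t ≤ b) : DominatedBy (t :: s) (b :: B) :=
  List.SublistForall₂.cons ⟨ht, htb⟩ h

theorem DominatedBy.exists_of_cons {s B : List ℕ} {t : ℕ} (h : DominatedBy (t :: s) B) :
    ∃ b B', List.Sublist (b :: B') B ∧ 2 ≤ t ∧ t ≤ b ∧ DominatedBy s B' := by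
  obtain ⟨l, h1, h2⟩ := List.sublistForall₂_iff.1 h
  cases h1 with
  | @cons _ b _ B' hb hB =>
    exact ⟨b, B', h2, hb.1, hb.2, List.sublistForall₂_iff.2 ⟨B', hB, List.Sublist.refl _⟩⟩

theorem truncMzvSpan_mono (K : Subfield ℂ) (u : ℕ) {B C : List ℕ} (h : List.Sublist B C) :
    truncMzvSpan K u B ≤ truncMzvSpan K u C := by
  refine Submodule.span_mono (Set.union_subset_union ?_ ?_)
  · rintro x ⟨s, hs, rfl⟩
    exact ⟨s, hs.mono h, rfl⟩
  · rintro x ⟨a, t, s, b, B', ha, ht, htb, hB, hs, rfl⟩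
    exact ⟨a, t, s, b, B', ha, ht, htb, hB.trans h, hs, rfl⟩

theorem polesSpan_mono (K : Subfield ℂ) {I J : Set ℕ} {b c : ℕ} (h : I ⊆ J) (hbc : b ≤ c) :
    polesSpan K I b ≤ polesSpan K J c := by
  refine Submodule.span_mono ?_
  rintro x ⟨M, h1, h2, rfl⟩
  exact ⟨M, h1, fun a ha => ⟨h (h2 a ha).1, (h2 a ha).2.trans hbc⟩, rfl⟩

theorem shiftedInv_ne_zero (a k : ℕ) : (k : ℂ) + 1 + a ≠ 0 := by
  have h : k + 1 + a ≠ 0 := by omega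
  exact_mod_cast h

theorem shiftedInv_mul (K : Subfield ℂ) {a b : ℕ} (h : a ≠ b) :
    shiftedInv a * shiftedInv b = ((b : K) - a)⁻¹ • (shiftedInv a - shiftedInv b) := by
  ext k
  have h1 := shiftedInv_ne_zero a k
  have h2 := shiftedInv_ne_zero b k
  have h3 : (b : ℂ) - a ≠ 0 := sub_ne_zero.2 (by exact_mod_cast h.symm)
  simp only [shiftedInv, Pi.mul_apply, Pi.smul_apply, Pi.sub_apply, Subfield.smul_def,
    Subfield.coe_inv, Subfield.coe_sub, SubringClass.coe_natCast, smul_eq_mul]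
  field_simp
  ring

theorem shiftedInv_pow_sub_mem (K : Subfield ℂ) {u b s : ℕ} (hs : 1 ≤ s) (hb : s ≤ b) (a : ℕ)
    (ha : a ≤ u) : shiftedInv a ^ s - shiftedInv 0 ^ s ∈ telescopingSpan K u b := by
  induction a with
  | zero => simp
  | succ a ih =>
    have hstep : shiftedInv a ^ s - shiftedInv (a + 1) ^ s ∈ telescopingSpan K u b :=
      Submodule.subset_span (Or.inr ⟨a, s, ha, hs, hb, rfl⟩)
    simpa using sub_mem (ih (by omega)) hstep

theorem prod_shiftedInv_mem (K : Subfield ℂ) {u b : ℕ} (M : Multiset ℕ) (hM : 2 ≤ M.card)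
    (h : ∀ a ∈ M, a ≤ u ∧ M.count a ≤ b) :
    (M.map shiftedInv).prod ∈ telescopingSpan K u b := by
  induction hn : M.card using Nat.strong_induction_on generalizing M with
  | _ n ih =>
  obtain ⟨a, ha⟩ := Multiset.card_pos_iff_exists_mem.1 (by omega : 0 < M.card)
  by_cases heq : ∀ c ∈ M, c = a
  · have hr := Multiset.eq_replicate_card.2 heq
    have hc : M.card ≤ b := by
      have := (h a ha).2
      rwa [hr, Multiset.count_replicate_self] at this
    rw [hr, Multiset.map_replicate, Multiset.prod_replicate, ← sub_add_cancel (shiftedInv a ^ _)]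
    exact add_mem (shiftedInv_pow_sub_mem K (by omega) hc a (h a ha).1)
      (Submodule.subset_span (Or.inl ⟨_, hM, hc, rfl⟩))
  push Not at heq
  obtain ⟨c, hc, hca⟩ := heq
  obtain ⟨M', rfl⟩ := Multiset.exists_cons_of_mem ha
  obtain ⟨N, rfl⟩ := Multiset.exists_cons_of_mem ((Multiset.mem_cons.1 hc).resolve_left hca)
  have key : ((a ::ₘ c ::ₘ N).map shiftedInv).prod = ((c : K) - a)⁻¹ •
      (((a ::ₘ N).map shiftedInv).prod - ((c ::ₘ N).map shiftedInv).prod) := by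
    simp only [Multiset.map_cons, Multiset.prod_cons]
    rw [← mul_assoc, shiftedInv_mul K hca.symm, smul_mul_assoc, sub_mul]
  rw [key]
  refine Submodule.smul_mem _ _ ?_
  have hb : 1 ≤ b := (Multiset.one_le_count_iff_mem.2 ha).trans (h a ha).2
  rcases N.empty_or_exists_mem with rfl | ⟨z, hz⟩
  · have h1 := shiftedInv_pow_sub_mem K le_rfl hb a (h a ha).1
    have h2 := shiftedInv_pow_sub_mem K le_rfl hb c (h c hc).1
    simpa using sub_mem h1 h2
  · have hN := Multiset.card_pos_iff_exists_mem.2 ⟨z, hz⟩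
    simp only [Multiset.card_cons] at hn
    have sub : ∀ M' : Multiset ℕ, M' ≤ a ::ₘ c ::ₘ N → M'.card = N.card + 1 →
        (M'.map shiftedInv).prod ∈ telescopingSpan K u b := by
      intro M' hM' hcard
      refine ih _ (by omega) M' (by omega) (fun x hx => ?_) hcard
      have := h x (Multiset.mem_of_le hM' hx)
      exact ⟨this.1, (Multiset.count_le_of_le x hM').trans this.2⟩
    refine sub_mem (sub _ ?_ (by simp)) (sub _ (Multiset.le_cons_self _ _) (by simp))
    exact Multiset.cons_le_cons _ (Multiset.le_cons_self _ _)

theorem polesSpan_le_telescopingSpan (K : Subfield ℂ) (u b : ℕ) :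
    polesSpan K (Set.Iic u) b ≤ telescopingSpan K u b := by
  refine Submodule.span_le.2 ?_
  rintro x ⟨M, h1, h2, rfl⟩
  exact prod_shiftedInv_mem K M h1 h2

theorem mul_shiftedInv_pow_mem (K : Subfield ℂ) {I J : Set ℕ} {a b c t : ℕ} (hI : I ⊆ J)
    (haI : a ∉ I) (haJ : a ∈ J) (hb : b ≤ c) (ht : t ≤ c) {f : ℕ → ℂ}
    (hf : f ∈ polesSpan K I b) : f * shiftedInv a ^ t ∈ polesSpan K J c := by
  induction hf using Submodule.span_induction with
  | zero => simp
  | add x y _ _ hx hy => rw [add_mul]; exact add_mem hx hy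
  | smul r x _ hx => rw [smul_mul_assoc]; exact Submodule.smul_mem _ _ hx
  | mem x hx =>
    obtain ⟨M, h1, h2, rfl⟩ := hx
    refine Submodule.subset_span ⟨M + Multiset.replicate t a, ?_, ?_, ?_⟩
    · simp only [Multiset.card_add]; omega
    · intro x hx
      have haM : a ∉ M := fun h => haI (h2 a h).1
      rw [Multiset.count_add, Multiset.count_replicate]
      rcases Multiset.mem_add.1 hx with hx | hx
      · have : a ≠ x := fun h => haM (h ▸ hx)
        rw [if_neg this]
        exact ⟨hI (h2 x hx).1, by have := (h2 x hx).2; omega⟩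
      · obtain rfl := Multiset.eq_of_mem_replicate hx
        rw [if_pos rfl, Multiset.count_eq_zero_of_notMem haM]
        exact ⟨haJ, by omega⟩
    · simp

theorem shiftedInv_pow_mul_mem (K : Subfield ℂ) {u a a' s t b : ℕ} (ha : a ≤ u) (ha' : a' ≤ u)
    (h : a ≠ a') (hs : 1 ≤ s) (ht : 1 ≤ t) (hsb : s ≤ b) (htb : t ≤ b) :
    shiftedInv a ^ s * shiftedInv a' ^ t ∈ polesSpan K (Set.Iic u) b := by
  refine Submodule.subset_span ⟨Multiset.replicate s a + Multiset.replicate t a', ?_, ?_, ?_⟩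
  · simp only [Multiset.card_add, Multiset.card_replicate]; omega
  · intro x hx
    simp only [Multiset.count_add, Multiset.count_replicate]
    rcases Multiset.mem_add.1 hx with hx | hx <;> obtain rfl := Multiset.eq_of_mem_replicate hx
    · simp [h.symm, ha, hsb]
    · simp [h, ha', htb]
  · simp

theorem partialSum_telescoping (e h : ℕ → ℂ) :
    partialSum ((e - fun k => e (k + 1)) * partialSum h) =
      partialSum ((fun k => e (k + 1)) * h) - e * partialSum h := by
  ext N
  simp only [partialSum, LinearMap.coe_mk, AddHom.coe_mk, Pi.sub_apply, Pi.mul_apply]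
  induction N with
  | zero => simp
  | succ N ih => simp only [sum_range_succ, ih]; ring

theorem partialSum_sub_shift (e : ℕ → ℂ) :
    partialSum (e - fun k => e (k + 1)) = e 0 • 1 - e := by
  ext N
  simp only [partialSum, LinearMap.coe_mk, AddHom.coe_mk, Pi.sub_apply, Pi.smul_apply,
    Pi.one_apply, smul_eq_mul, mul_one]
  exact sum_range_sub' e N

theorem shiftedInv_pow_succ_eq_shift (a s : ℕ) :
    shiftedInv (a + 1) ^ s = fun k => (shiftedInv a ^ s) (k + 1) := by
  ext k
  simp only [shiftedInv, Pi.pow_apply]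
  push_cast
  ring_nf

/-- Summing a normalised truncated multiple zeta value against a rational function. -/
theorem partialSum_mul_truncMzv_mem (K : Subfield ℂ) (u : ℕ) (s : List ℕ) :
    ∀ (B : List ℕ) (b : ℕ) (g : ℕ → ℂ), DominatedBy s B → g ∈ polesSpan K (Set.Iic u) b →
      partialSum (g * truncMzv s) ∈ truncMzvSpan K u (b :: B) := by
  induction s with
  | nil =>
    intro B b g hs hg
    replace hg := polesSpan_le_telescopingSpan K u b hg
    induction hg using Submodule.span_induction with
    | zero => simp
    | add x y _ _ hx hy => rw [add_mul, map_add]; exact add_mem hx hy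
    | smul r x _ hx =>
      rw [smul_mul_assoc, LinearMap.map_smul_of_tower]; exact Submodule.smul_mem _ _ hx
    | mem x hx =>
      rcases hx with ⟨t, h2, hb, rfl⟩ | ⟨a, t, ha, h1, hb, rfl⟩
      · exact Submodule.subset_span (Or.inl ⟨[t], hs.cons h2 hb, rfl⟩)
      · have h1' : truncMzv [] = 1 := rfl
        rw [h1', mul_one, shiftedInv_pow_succ_eq_shift, partialSum_sub_shift]
        refine sub_mem ?_ ?_
        · have : (shiftedInv a ^ t) 0 • (1 : ℕ → ℂ) = (((1 : K) + a)⁻¹ ^ t) • truncMzv [] := by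
            ext k; simp [h1', shiftedInv, Subfield.smul_def]
          rw [this]
          exact Submodule.smul_mem _ _
            (Submodule.subset_span (Or.inl ⟨[], List.SublistForall₂.nil, rfl⟩))
        · exact Submodule.subset_span (Or.inr ⟨a, t, [], b, B, ha, h1, hb, List.Sublist.refl _,
            List.SublistForall₂.nil, by rw [h1', mul_one]⟩)
  | cons s₁ s ih =>
    intro B b g hs hg
    replace hg := polesSpan_le_telescopingSpan K u b hg
    induction hg using Submodule.span_induction with
    | zero => simp
    | add x y _ _ hx hy => rw [add_mul, map_add]; exact add_mem hx hy
    | smul r x _ hx =>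
      rw [smul_mul_assoc, LinearMap.map_smul_of_tower]; exact Submodule.smul_mem _ _ hx
    | mem x hx =>
      rcases hx with ⟨t, h2, hb, rfl⟩ | ⟨a, t, ha, h1, hb, rfl⟩
      · exact Submodule.subset_span (Or.inl ⟨t :: s₁ :: s, hs.cons h2 hb, rfl⟩)
      · have h1' : truncMzv (s₁ :: s) = partialSum (shiftedInv 0 ^ s₁ * truncMzv s) := rfl
        rw [shiftedInv_pow_succ_eq_shift, h1', partialSum_telescoping, ← h1',
          ← shiftedInv_pow_succ_eq_shift, ← mul_assoc]
        refine sub_mem ?_ (Submodule.subset_span (Or.inr ⟨a, t, _, b, B, ha, h1, hb,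
          List.Sublist.refl _, hs, rfl⟩))
        obtain ⟨b₁, B', hB, h2, hb₁, hs'⟩ := hs.exists_of_cons
        have hmem : ∀ c, t ≤ c → s₁ ≤ c →
            partialSum (shiftedInv (a + 1) ^ t * shiftedInv 0 ^ s₁ * truncMzv s) ∈
              truncMzvSpan K u (c :: B') := fun c htc hsc =>
          ih B' c _ hs' (shiftedInv_pow_mul_mem K ha (Nat.zero_le _) (Nat.succ_ne_zero a) h1
            (by omega) htc hsc)
        rcases le_total b b₁ with h | h
        · exact truncMzvSpan_mono K u (hB.trans (List.sublist_cons_self _ _))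
            (hmem b₁ (hb.trans h) hb₁)
        · exact truncMzvSpan_mono K u (((List.sublist_cons_self _ _).trans hB).cons_cons b)
            (hmem b hb (hb₁.trans h))

/-- Nested sums of rational functions with ordered poles reduce to truncated multiple zeta
values. -/
theorem nestedSum_mem (K : Subfield ℂ) (q : ℕ) : ∀ (f : Fin q → ℕ → ℂ) (b l u : Fin q → ℕ) (U : ℕ),
    (∀ i, f i ∈ polesSpan K (Set.Icc (l i) (u i)) (b i)) → (∀ i j, i < j → u j ≤ l i) →
    (∀ i, l i ≤ u i) → (∀ i, u i ≤ U) →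
      nestedSum (List.ofFn f) ∈ truncMzvSpan K U (List.ofFn b) := by
  induction q with
  | zero =>
    intro f b l u U _ _ _ _
    simp only [List.ofFn_zero]
    exact Submodule.subset_span (Or.inl ⟨[], List.SublistForall₂.nil, rfl⟩)
  | succ q ih =>
    intro f b l u U hf hul hlu hU
    have hrec := ih (fun i => f i.succ) (fun i => b i.succ) (fun i => l i.succ)
      (fun i => u i.succ) (l 0) (fun i => hf _) (fun i j h => hul _ _ (Fin.succ_lt_succ_iff.2 h))
      (fun i => hlu _) (fun i => hul _ _ (Fin.succ_pos i))
    have hsub : Set.Icc (l 0) (u 0) ⊆ Set.Iic U := fun x hx => hx.2.trans (hU 0)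
    rw [List.ofFn_succ, List.ofFn_succ]
    change partialSum (f 0 * nestedSum (List.ofFn fun i => f i.succ)) ∈ _
    generalize (nestedSum (List.ofFn fun i => f i.succ)) = y at hrec ⊢
    induction hrec using Submodule.span_induction with
    | zero => simp
    | add x y _ _ hx hy => rw [mul_add, map_add]; exact add_mem hx hy
    | smul r x _ hx =>
      rw [mul_smul_comm, LinearMap.map_smul_of_tower]; exact Submodule.smul_mem _ _ hx
    | mem x hx =>
      rcases hx with ⟨s, hs, rfl⟩ | ⟨a, t, s, c, B', ha, h1, htc, hB, hs, rfl⟩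
      · exact partialSum_mul_truncMzv_mem K U s _ _ _ hs (polesSpan_mono K hsub le_rfl (hf 0))
      · have hmem : ∀ d, b 0 ≤ d → t ≤ d →
            partialSum (f 0 * shiftedInv a ^ t * truncMzv s) ∈ truncMzvSpan K U (d :: B') :=
          fun d hbd htd => partialSum_mul_truncMzv_mem K U s _ _ _ hs
            (mul_shiftedInv_pow_mem K hsub (fun h => absurd h.1 (by omega))
              ((ha.le.trans (hlu 0)).trans (hU 0)) hbd htd (hf 0))
        rw [← mul_assoc]
        rcases le_total (b 0) c with h | h
        · exact truncMzvSpan_mono K U (hB.trans (List.sublist_cons_self _ _)) (hmem c h htc)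
        · exact truncMzvSpan_mono K U (((List.sublist_cons_self _ _).trans hB).cons_cons _)
            (hmem _ le_rfl (htc.trans h))

theorem numerator_mul_prod_mem (K : Subfield ℂ) {I : Set ℕ} {b : ℕ} (c d : ℕ) (M : Multiset ℕ)
    (hd : d + 2 ≤ M.card) (h : ∀ a ∈ M, a ∈ I ∧ M.count a ≤ b) :
    (fun k : ℕ => (k : ℂ) + 1 - c) ^ d * (M.map shiftedInv).prod ∈ polesSpan K I b := by
  induction d generalizing M with
  | zero => exact Submodule.subset_span ⟨M, by omega, h, by simp⟩
  | succ d ih =>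
    obtain ⟨a, ha⟩ := Multiset.card_pos_iff_exists_mem.1 (by omega : 0 < M.card)
    obtain ⟨N, rfl⟩ := Multiset.exists_cons_of_mem ha
    have h1 : (fun k : ℕ => (k : ℂ) + 1 - c) * shiftedInv a = 1 - ((a : K) + c) • shiftedInv a := by
      ext k
      have := shiftedInv_ne_zero a k
      simp only [shiftedInv, Pi.mul_apply, Pi.smul_apply, Pi.sub_apply, Pi.one_apply,
        Subfield.smul_def, Subfield.coe_add, SubringClass.coe_natCast, smul_eq_mul]
      field_simp
      ring
    have key : (fun k : ℕ => (k : ℂ) + 1 - c) ^ (d + 1) * ((a ::ₘ N).map shiftedInv).prod =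
        (fun k : ℕ => (k : ℂ) + 1 - c) ^ d * (N.map shiftedInv).prod -
        ((a : K) + c) • ((fun k : ℕ => (k : ℂ) + 1 - c) ^ d *
          ((a ::ₘ N).map shiftedInv).prod) := by
      rw [Multiset.map_cons, Multiset.prod_cons, pow_succ, mul_assoc, ← mul_assoc _ (shiftedInv a),
        h1, sub_mul, mul_sub, one_mul, smul_mul_assoc, mul_smul_comm]
    rw [key]
    refine sub_mem (ih N ?_ fun x hx => ?_) (Submodule.smul_mem _ _ (ih _ (by omega) h))
    · rw [Multiset.card_cons] at hd; omega
    · have := h x (Multiset.mem_cons_of_mem hx)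
      exact ⟨this.1, (Multiset.count_le_count_cons _ _ _).trans this.2⟩

theorem norm_shiftedInv_le (a k : ℕ) : ‖shiftedInv a k‖ ≤ ((k : ℝ) + 1)⁻¹ := by
  have : (k : ℂ) + 1 + a = ((k + 1 + a : ℝ) : ℂ) := by push_cast; rfl
  rw [shiftedInv, this, norm_inv, Complex.norm_of_nonneg (by positivity)]
  exact inv_anti₀ (by positivity) (le_add_of_nonneg_right (Nat.cast_nonneg a))

theorem norm_prod_shiftedInv_le (M : Multiset ℕ) (k : ℕ) :
    ‖(M.map shiftedInv).prod k‖ ≤ ((k : ℝ) + 1)⁻¹ ^ M.card := by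
  induction M using Multiset.induction_on with
  | empty => simp
  | cons a M ih =>
    rw [Multiset.map_cons, Multiset.prod_cons, Pi.mul_apply, norm_mul, Multiset.card_cons,
      pow_succ']
    exact mul_le_mul (norm_shiftedInv_le a k) ih (norm_nonneg _) (by positivity)

theorem summable_norm_of_mem_polesSpan (K : Subfield ℂ) {I : Set ℕ} {b : ℕ} {f : ℕ → ℂ}
    (hf : f ∈ polesSpan K I b) : Summable fun k => ‖f k‖ := by
  induction hf using Submodule.span_induction with
  | zero => simp
  | add x y _ _ hx hy =>
    exact Summable.of_nonneg_of_le (fun _ => norm_nonneg _) (fun _ => norm_add_le _ _) (hx.add hy)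
  | smul r x _ hx =>
    refine (hx.mul_left ‖(r : ℂ)‖).congr fun k => ?_
    rw [Pi.smul_apply, Subfield.smul_def, smul_eq_mul, norm_mul]
  | mem x hx =>
    obtain ⟨M, h1, -, rfl⟩ := hx
    have hs : Summable fun k : ℕ => ((k : ℝ) + 1)⁻¹ ^ 2 := by
      have := (summable_nat_add_iff 1).2 (Real.summable_nat_pow_inv.2 one_lt_two)
      simpa using this
    refine Summable.of_nonneg_of_le (fun _ => norm_nonneg _) (fun k => ?_) hs
    refine (norm_prod_shiftedInv_le M k).trans (pow_le_pow_of_le_one (by positivity) ?_ h1)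
    exact inv_le_one_of_one_le₀ (by simp)

theorem summable_prod_of_summable {q : ℕ} (g : Fin q → ℕ → ℝ) (h0 : ∀ i k, 0 ≤ g i k)
    (hg : ∀ i, Summable (g i)) : Summable fun k : Fin q → ℕ => ∏ i, g i (k i) := by
  induction q with
  | zero => exact Summable.of_finite
  | succ q ih =>
    rw [← (Fin.consEquiv fun _ : Fin (q + 1) => ℕ).summable_iff]
    refine ((hg 0).mul_of_nonneg (ih (fun i => g i.succ) (fun i => h0 _) fun i => hg _) (h0 0)
      fun k => prod_nonneg fun i _ => h0 _ _).congr fun x => ?_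
    simp [Fin.prod_univ_succ]

theorem strictAnti_cons_iff {q a : ℕ} {k : Fin q → ℕ} :
    StrictAnti (Fin.cons a k : Fin (q + 1) → ℕ) ↔ (∀ i, k i < a) ∧ StrictAnti k := by
  refine ⟨fun h => ⟨fun i => ?_, fun i j hij => ?_⟩, fun h i j hij => ?_⟩
  · simpa using h (Fin.succ_pos i)
  · simpa using h (Fin.succ_lt_succ_iff.2 hij)
  · induction j using Fin.cases with
    | zero => simp at hij
    | succ j =>
      induction i using Fin.cases with
      | zero => simpa using h.1 j
      | succ i => simpa using h.2 (Fin.succ_lt_succ_iff.1 hij)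

open Classical in
theorem nestedSum_ofFn {q : ℕ} (f : Fin q → ℕ → ℂ) (N : ℕ) :
    nestedSum (List.ofFn f) N =
      ∑ k ∈ (Fintype.piFinset fun _ : Fin q => range N) with StrictAnti k, ∏ i, f i (k i) := by
  induction q generalizing N with
  | zero =>
    have : ∀ k : Fin 0 → ℕ, StrictAnti k := fun k i => i.elim0
    simp [nestedSum, this]
  | succ q ih =>
    rw [List.ofFn_succ]
    change ∑ k ∈ range N, f 0 k * nestedSum (List.ofFn fun i => f i.succ) k = _
    simp_rw [ih, mul_sum]
    rw [sum_sigma']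
    refine sum_bij' (fun x _ => (Fin.cons x.1 x.2 : Fin (q + 1) → ℕ))
      (fun k _ => ⟨k 0, Fin.tail k⟩) ?_ ?_ ?_ ?_ ?_
    · rintro ⟨a, k⟩ h
      simp only [mem_sigma, mem_filter, Fintype.mem_piFinset, mem_range] at h ⊢
      refine ⟨fun i => ?_, strictAnti_cons_iff.2 h.2⟩
      induction i using Fin.cases with
      | zero => simpa using h.1
      | succ i => simpa using (h.2.1 i).trans h.1
    · intro k h
      simp only [mem_sigma, mem_filter, Fintype.mem_piFinset, mem_range] at h ⊢
      refine ⟨h.1 0, strictAnti_cons_iff.1 ?_⟩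
      rw [Fin.cons_self_tail]
      exact h.2
    · rintro ⟨a, k⟩ _
      simp
    · intro k _
      simp
    · rintro ⟨a, k⟩ _
      simp [Fin.prod_univ_succ]

/-- An absolutely convergent series over strictly decreasing tuples is the limit of its nested
sums, for any parametrisation of these tuples. -/
theorem exists_hasSum_nestedSum {q : ℕ} (f : Fin q → ℕ → ℂ) (hf : ∀ i, Summable fun k => ‖f i k‖)
    {X : Type*} (φ : X → Fin q → ℕ) (hφ : Function.Injective φ)
    (hr : ∀ k, k ∈ Set.range φ ↔ StrictAnti k) :
    ∃ S : ℂ, HasSum (fun x => ∏ i, f i (φ x i)) S ∧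
      Tendsto (nestedSum (List.ofFn f)) atTop (𝓝 S) := by
  classical
  set G : (Fin q → ℕ) → ℂ := fun k => if StrictAnti k then ∏ i, f i (k i) else 0 with hG
  have hsum : Summable G := by
    refine Summable.of_norm_bounded
      (summable_prod_of_summable (fun i k => ‖f i k‖) (fun _ _ => norm_nonneg _) hf) fun k => ?_
    rw [hG, ← norm_prod]
    dsimp only
    split_ifs
    · exact le_rfl
    · simpa using prod_nonneg fun i _ => norm_nonneg (f i (k i))
  refine ⟨∑' k, G k, ?_, ?_⟩
  · have h1 : (fun x => ∏ i, f i (φ x i)) = G ∘ φ := by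
      ext x
      simp [hG, (hr (φ x)).1 ⟨x, rfl⟩]
    rw [h1, hφ.hasSum_iff]
    · exact hsum.hasSum
    · intro k hk
      rw [hr] at hk
      simp [hG, hk]
  · have h2 : nestedSum (List.ofFn f) =
        (fun s : Finset (Fin q → ℕ) => ∑ k ∈ s, G k) ∘
          fun N => Fintype.piFinset fun _ : Fin q => range N := by
      ext N
      rw [nestedSum_ofFn, sum_filter]
      rfl
    rw [h2]
    refine Tendsto.comp hsum.hasSum (tendsto_atTop_finset_of_monotone ?_ fun k => ?_)
    · exact fun a b hab => Fintype.piFinset_subset _ _ fun _ => range_mono hab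
    · refine ⟨univ.sup k + 1, ?_⟩
      simp only [Fintype.mem_piFinset, mem_range]
      exact fun i => Nat.lt_succ_of_le (le_sup (mem_univ i))

theorem shiftedInv_zero_pow_mem (K : Subfield ℂ) {t : ℕ} (ht : 2 ≤ t) :
    shiftedInv 0 ^ t ∈ polesSpan K (Set.Iic 0) t := by
  refine Submodule.subset_span ⟨Multiset.replicate t 0, by simpa using ht, fun a ha => ?_, by simp⟩
  obtain rfl := Multiset.eq_of_mem_replicate ha
  simp

theorem DominatedBy.two_le {s B : List ℕ} (h : DominatedBy s B) (i : Fin s.length) :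
    2 ≤ s.get i := by
  obtain ⟨l, h1, -⟩ := List.sublistForall₂_iff.1 h
  exact (h1.get i.2 (h1.length_eq ▸ i.2)).1

theorem tendsto_truncMzv {s : List ℕ} (hs : ∀ i : Fin s.length, 2 ≤ s.get i) :
    Tendsto (truncMzv s) atTop (𝓝 (mzv s : ℂ)) := by
  obtain ⟨S, h1, h2⟩ := exists_hasSum_nestedSum (fun i : Fin s.length => shiftedInv 0 ^ s.get i)
    (fun i => summable_norm_of_mem_polesSpan ⊤ (shiftedInv_zero_pow_mem ⊤ (hs i)))
    (fun (k : {k : Fin s.length → ℕ // StrictAnti k ∧ ∀ i, 1 ≤ k i}) i => k.1 i - 1)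
    (fun k l h => Subtype.ext (funext fun i => by
      have : k.1 i - 1 = l.1 i - 1 := congrFun h i
      have := k.2.2 i
      have := l.2.2 i
      omega))
    (fun k => ⟨by
      rintro ⟨l, rfl⟩ i j hij
      have := l.2.1 hij
      have := l.2.2 j
      dsimp only
      omega, fun hk => ⟨⟨fun i => k i + 1, fun i j hij => Nat.succ_lt_succ (hk hij),
        fun i => Nat.succ_pos _⟩, rfl⟩⟩)
  have hS : S = (mzv s : ℂ) := by
    rw [mzv, Complex.ofReal_tsum, ← h1.tsum_eq]
    refine tsum_congr fun k => ?_
    push_cast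
    refine prod_congr rfl fun i _ => ?_
    simp only [Pi.pow_apply, shiftedInv, Nat.cast_sub (k.2.2 i)]
    simp
  rw [← hS]
  convert h2 using 1
  rw [truncMzv]
  congr 1
  apply List.ext_get <;> simp

theorem tendsto_shiftedInv_pow (a : ℕ) {t : ℕ} (ht : 1 ≤ t) :
    Tendsto (shiftedInv a ^ t) atTop (𝓝 0) := by
  have h : Tendsto (shiftedInv a) atTop (𝓝 0) := by
    refine squeeze_zero_norm (norm_shiftedInv_le a) ?_
    simpa using tendsto_one_div_add_atTop_nhds_zero_nat (𝕜 := ℝ)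
  have h' := h.pow t
  rwa [zero_pow (by omega : t ≠ 0)] at h'

theorem exists_tendsto_of_mem_truncMzvSpan (K : Subfield ℂ) {u : ℕ} {B : List ℕ} {x : ℕ → ℂ}
    (hx : x ∈ truncMzvSpan K u B) :
    ∃ S ∈ Submodule.span K ((fun s => (mzv s : ℂ)) '' {s | DominatedBy s B}),
      Tendsto x atTop (𝓝 S) := by
  induction hx using Submodule.span_induction with
  | zero => exact ⟨0, zero_mem _, tendsto_const_nhds⟩
  | add x y _ _ hx hy =>
    obtain ⟨S, hS, h1⟩ := hx
    obtain ⟨T, hT, h2⟩ := hy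
    exact ⟨S + T, add_mem hS hT, h1.add h2⟩
  | smul r x _ hx =>
    obtain ⟨S, hS, h1⟩ := hx
    exact ⟨r • S, Submodule.smul_mem _ _ hS, h1.const_mul (r : ℂ)⟩
  | mem x hx =>
    rcases hx with ⟨s, hs, rfl⟩ | ⟨a, t, s, b, B', -, h1, -, -, hs, rfl⟩
    · exact ⟨_, Submodule.subset_span ⟨s, hs, rfl⟩, tendsto_truncMzv hs.two_le⟩
    · have h := (tendsto_shiftedInv_pow a h1).mul (tendsto_truncMzv hs.two_le)
      rw [zero_mul] at h
      exact ⟨0, zero_mem _, h⟩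

theorem DominatedBy.exists_strictMono {p : ℕ} {A : ℕ → ℕ} {s : List ℕ}
    (h : DominatedBy s (List.ofFn fun i : Fin p => A i.1)) :
    s.length ≤ p ∧ ∃ idx : Fin s.length → Fin p, StrictMono idx ∧
      ∀ l : Fin s.length, 2 ≤ s.get l ∧ s.get l ≤ A (idx l).1 := by
  obtain ⟨l, h1, h2⟩ := List.sublistForall₂_iff.1 h
  have hlen := h1.length_eq
  refine ⟨by simpa [hlen] using h2.length_le, ?_⟩
  obtain ⟨g, hg⟩ := List.sublist_iff_exists_fin_orderEmbedding_get_eq.1 h2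
  refine ⟨fun i => Fin.cast (by simp) (g (Fin.cast hlen i)), fun i j hij => ?_, fun i => ?_⟩
  · exact g.strictMono (a := Fin.cast hlen i) (b := Fin.cast hlen j) hij
  · have h3 := h1.get i.2 (hlen ▸ i.2)
    have h4 := hg (Fin.cast hlen i)
    refine ⟨h3.1, h3.2.trans (le_of_eq ?_)⟩
    simpa using h4

/-- The factor of the summand attached to one variable, in shifted form. -/
noncomputable def variableFactor (c d ρ n A : ℕ) : ℕ → ℂ :=
  (fun k : ℕ => (k : ℂ) + 1 - c) ^ d *
    ((A • (Multiset.range (n + 1)).map (ρ + ·)).map shiftedInv).prod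

theorem variableFactor_mem (K : Subfield ℂ) {c d ρ n A : ℕ} (h : d + 2 ≤ A * (n + 1)) :
    variableFactor c d ρ n A ∈ polesSpan K (Set.Icc ρ (ρ + n)) A := by
  refine numerator_mul_prod_mem K c d _ (by simpa using h) fun a ha => ⟨?_, ?_⟩
  · obtain ⟨j, hj, rfl⟩ := Multiset.mem_map.1 (Multiset.mem_of_mem_nsmul ha)
    rw [Multiset.mem_range] at hj
    exact ⟨by omega, by omega⟩
  · rw [Multiset.count_nsmul]
    refine mul_le_of_le_one_right (Nat.zero_le _) (Multiset.nodup_iff_count_le_one.1 ?_ a)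
    exact (Multiset.nodup_range _).map (add_right_injective ρ)

theorem variableFactor_apply {c d ρ n A r k m : ℕ} (h1 : m + 1 = k + c) (h2 : r = ρ + c) :
    variableFactor c d ρ n A m =
      (k : ℂ) ^ d / ((ascPochhammer ℂ (n + 1)).eval ((k : ℂ) + (r : ℂ))) ^ A := by
  have h3 : (m : ℂ) + 1 = k + c := by exact_mod_cast h1
  have h4 : ((Multiset.range (n + 1)).map (ρ + ·) |>.map shiftedInv).prod m =
      ((ascPochhammer ℂ (n + 1)).eval ((k : ℂ) + (r : ℂ)))⁻¹ := by
    rw [Multiset.map_map]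
    change (∏ j ∈ range (n + 1), shiftedInv (ρ + j)) m = _
    generalize n + 1 = N
    induction N with
    | zero => simp
    | succ N ih =>
      rw [prod_range_succ, Pi.mul_apply, ih, ascPochhammer_succ_eval, mul_inv]
      simp only [shiftedInv]
      rw [h3, h2]
      push_cast
      ring
  simp only [variableFactor, Multiset.map_nsmul, Multiset.prod_nsmul, Pi.mul_apply, Pi.pow_apply]
  rw [h4, h3]
  simp [div_eq_mul_inv]

theorem statement2 (p : ℕ) (hp : 0 < p) (A n r : ℕ → ℕ) (K : Subfield ℂ)
    (P : MvPolynomial (Fin p) K)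
    (h9 : ∀ j : Fin p, (∑ i ∈ Finset.Iic j, P.degreeOf i) + j.1 + 2 ≤
      ∑ i ∈ Finset.Iic j, A i.1 * (n i.1 + 1))
    (h11 : ∀ i : ℕ, i + 1 < p → r (i + 1) + n (i + 1) + 1 ≤ r i)
    (h12 : ∀ i : Fin p, P.degreeOf i + 2 ≤ A i.1 * (n i.1 + 1)) :
    Summable (fun k : {k : Fin p → ℕ // Antitone k ∧ ∀ i, 1 ≤ k i} =>
        Rfun p K A n r P (fun i => (k.1 i : ℂ))) ∧
    ∃ (T : Finset (List ℕ)) (c : List ℕ → K),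
      (∀ s ∈ T, s.length ≤ p ∧
        ∃ idx : Fin s.length → Fin p, StrictMono idx ∧
          ∀ l : Fin s.length, 2 ≤ s.get l ∧ s.get l ≤ A (idx l).1) ∧
      (∑' k : {k : Fin p → ℕ // Antitone k ∧ ∀ i, 1 ≤ k i},
          Rfun p K A n r P (fun i => (k.1 i : ℂ)))
        = ∑ s ∈ T, (c s : ℂ) * (mzv s : ℂ) := by
  have hr : ∀ i d : ℕ, i + d + 1 < p →
      r (i + d + 1) + n (i + d + 1) + (d + 1) ≤ r i := by
    intro i d
    induction d with
    | zero => intro h; exact h11 i h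
    | succ d ih =>
      intro h
      have h1 := ih (by omega)
      have h2 := h11 (i + d + 1) h
      rw [← add_assoc i d 1]
      omega
  have hr' : ∀ i j : ℕ, i < j → j < p → r j + n j + (j - i) ≤ r i := by
    intro i j hij hj
    obtain ⟨d, rfl⟩ := Nat.exists_eq_add_of_lt hij
    have := hr i d hj
    omega
  have hrc : ∀ i < p, p - 1 - i ≤ r i := by
    intro i hi
    rcases Nat.lt_or_ge i (p - 1) with h | h
    · have := hr' i (p - 1) h (by omega)
      omega
    · omega
  have hterm : ∀ d ∈ P.support, ∃ S ∈ Submodule.span K ((fun s => (mzv s : ℂ)) ''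
      {s | DominatedBy s (List.ofFn fun i : Fin p => A i.1)}),
      HasSum (fun k : {k : Fin p → ℕ // Antitone k ∧ ∀ i, 1 ≤ k i} =>
        ∏ i, (k.1 i : ℂ) ^ d i /
          ((ascPochhammer ℂ (n i.1 + 1)).eval ((k.1 i : ℂ) + (r i.1 : ℂ))) ^ A i.1) S := by
    intro d hd
    set f : Fin p → ℕ → ℂ := fun i =>
      variableFactor (p - 1 - i.1) (d i) (r i.1 - (p - 1 - i.1)) (n i.1) (A i.1) with hf
    have hmem : ∀ i, f i ∈ polesSpan K
        (Set.Icc (r i.1 - (p - 1 - i.1)) (r i.1 - (p - 1 - i.1) + n i.1)) (A i.1) := by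
      intro i
      have := MvPolynomial.monomial_le_degreeOf i hd
      exact variableFactor_mem K (le_trans (by omega) (h12 i))
    obtain ⟨S, h1, h2⟩ := exists_hasSum_nestedSum f
      (fun i => summable_norm_of_mem_polesSpan K (hmem i))
      (fun (k : {k : Fin p → ℕ // Antitone k ∧ ∀ i, 1 ≤ k i}) i => k.1 i - 1 + (p - 1 - i.1))
      (fun k l h => Subtype.ext (funext fun i => by
        have : k.1 i - 1 + (p - 1 - i.1) = l.1 i - 1 + (p - 1 - i.1) := congrFun h i
        have := k.2.2 i
        have := l.2.2 i
        omega))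
      (fun k => ⟨by
        rintro ⟨l, rfl⟩ i j hij
        have := l.2.1 hij.le
        have := l.2.2 j
        have := j.2
        have : i.1 < j.1 := hij
        dsimp only
        omega, fun hk => by
        have hstep : ∀ (m : ℕ) (i j : Fin p), i.1 + m = j.1 → k j + m ≤ k i := by
          intro m
          induction m with
          | zero => intro i j h; rw [Fin.ext h]; rfl
          | succ m ih =>
            intro i j h
            have h1 := ih i ⟨i.1 + m, by omega⟩ rfl
            have h2 : k j < k ⟨i.1 + m, by omega⟩ := hk (by rw [Fin.lt_def]; simp; omega)
            omega
        have hge : ∀ i : Fin p, p - 1 - i.1 ≤ k i := fun i => by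
          have := hstep (p - 1 - i.1) i ⟨p - 1, by omega⟩ (by simp; omega)
          omega
        refine ⟨⟨fun i => k i + 1 - (p - 1 - i.1), fun i j hij => ?_, fun i => ?_⟩, ?_⟩
        · have h1 : i.1 ≤ j.1 := hij
          have := hstep (j.1 - i.1) i j (by omega)
          have := hge j
          dsimp only
          omega
        · have := hge i
          change 1 ≤ k i + 1 - (p - 1 - i.1)
          omega
        · ext i
          have := hge i
          change k i + 1 - (p - 1 - i.1) - 1 + (p - 1 - i.1) = k i
          omega⟩)
    have hS := nestedSum_mem K p f (fun i => A i.1) (fun i => r i.1 - (p - 1 - i.1))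
      (fun i => r i.1 - (p - 1 - i.1) + n i.1)
      (univ.sup fun i : Fin p => r i.1 - (p - 1 - i.1) + n i.1) hmem
      (fun i j hij => by
        have := hr' i.1 j.1 hij j.2
        have := hrc j.1 j.2
        have := hrc i.1 i.2
        have : i.1 < j.1 := hij
        omega)
      (fun i => Nat.le_add_right _ _)
      (fun i => le_sup (f := fun i : Fin p => r i.1 - (p - 1 - i.1) + n i.1) (mem_univ i))
    obtain ⟨S', hS', h3⟩ := exists_tendsto_of_mem_truncMzvSpan K hS
    obtain rfl := tendsto_nhds_unique h2 h3
    refine ⟨S, hS', ?_⟩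
    convert h1 using 4 with k i
    rw [hf]
    refine (variableFactor_apply ?_ ?_).symm
    · have := k.2.2 i
      omega
    · have := hrc i.1 i.2
      omega
  choose! S hS hsum using hterm
  have htotal : HasSum (fun k : {k : Fin p → ℕ // Antitone k ∧ ∀ i, 1 ≤ k i} =>
      Rfun p K A n r P (fun i => (k.1 i : ℂ))) (∑ d ∈ P.support, ((P.coeff d : K) : ℂ) * S d) := by
    have hR : ∀ k : Fin p → ℂ, Rfun p K A n r P k = ∑ d ∈ P.support, ((P.coeff d : K) : ℂ) *
        ∏ i, k i ^ d i / ((ascPochhammer ℂ (n i.1 + 1)).eval (k i + (r i.1 : ℂ))) ^ A i.1 := by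
      intro k
      rw [Rfun, MvPolynomial.eval₂_eq', sum_div]
      refine sum_congr rfl fun d _ => ?_
      rw [prod_div_distrib, mul_div_assoc]
      rfl
    simp_rw [hR]
    exact hasSum_sum fun d hd => (hsum d hd).mul_left _
  refine ⟨htotal.summable, ?_⟩
  have hspan : ∑ d ∈ P.support, ((P.coeff d : K) : ℂ) * S d ∈ Submodule.span K
      ((fun s => (mzv s : ℂ)) '' {s | DominatedBy s (List.ofFn fun i : Fin p => A i.1)}) :=
    sum_mem fun d hd => Submodule.smul_mem _ (P.coeff d) (hS d hd)
  obtain ⟨c, hc, hc'⟩ := (Finsupp.mem_span_image_iff_linearCombination K).1 hspan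
  refine ⟨c.support, c, fun s hs => ?_, ?_⟩
  · exact DominatedBy.exists_strictMono (hc hs)
  · rw [htotal.tsum_eq, ← hc', Finsupp.linearCombination_apply, Finsupp.sum]
    rfl
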